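/- Let n≥1, s>0 and define f(x) := 2 Σ_{k∈G^n} e^{-s|k|_1} cos(k·x). Then ‖f‖_s = 1, π_{Zk}f(θ) = 2 e^{-s|k|_1} cos θ for every k∈G^n, liminf_{k∈G^n, |k|_1→∞} |f_k| e^{s|k|_1}|k|_1^n = +∞, and consequently f belongs to G^n_s. -/

import Mathlib

noncomputable section
open Complex

/-- The ℓ¹ norm of an integer vector. -/
def norm1 {n : ℕ} (k : Fin n → ℤ) : ℕ := ∑ i, (k i).natAbs

/-- Integer vectors whose first nonzero component is positive. -/
def Zstar (n : ℕ) : Set (Fin n → ℤ) := {k | ∃ j, 0 < k j ∧ ∀ i, i < j → k i = 0}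

/-- Generators of one-dimensional maximal lattices in ℤⁿ. -/
def gen (n : ℕ) : Set (Fin n → ℤ) :=
  {k | k ∈ Zstar n ∧ Finset.univ.gcd (fun i => (k i).natAbs) = 1}

/-- Generators of size at most `K`. -/
def genK (n : ℕ) (K : ℝ) : Set (Fin n → ℤ) := {k | k ∈ gen n ∧ (norm1 k : ℝ) ≤ K}

/-- `c` is the family of Fourier coefficients of a zero-average real analytic
function in the closed unit ball of the norm `‖f‖ₛ = sup |f_k| e^{s|k|₁}`. -/
structure InBall (n : ℕ) (s : ℝ) (c : (Fin n → ℤ) → ℂ) : Prop where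
  zero : c 0 = 0
  real : ∀ k, c (-k) = (starRingEnd ℂ) (c k)
  bound : ∀ k, ‖c k‖ * Real.exp (s * norm1 k) ≤ 1

/-- The Fourier cut-off `N(δ)`. -/
def Ncut (n : ℕ) (s δ : ℝ) : ℝ :=
  2 * max 1 (1/s * Real.log (2^44 * (2*(n:ℝ) / Real.exp 1)^n / (s^n * δ)))

/-- Condition (P1+) with parameter δ. -/
def P1plus (n : ℕ) (s δ : ℝ) (c : (Fin n → ℤ) → ℂ) : Prop :=
  ∀ k ∈ gen n, Ncut n s δ ≤ (norm1 k : ℝ) →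
    δ / (norm1 k : ℝ)^n * Real.exp (-(s * norm1 k)) ≤ ‖c k‖

/-- Complex extension of the Fourier projection `π_{ℤk} f` onto modes proportional to `k`. -/
def projC {n : ℕ} (c : (Fin n → ℤ) → ℂ) (k : Fin n → ℤ) (θ : ℂ) : ℂ :=
  ∑' j : ℤ, if j = 0 then 0 else c (j • k) * Complex.exp (Complex.I * (j : ℂ) * θ)

/-- Real restriction of the Fourier projection `π_{ℤk} f`. -/
def projR {n : ℕ} (c : (Fin n → ℤ) → ℂ) (k : Fin n → ℤ) (θ : ℝ) : ℝ :=
  (projC c k (θ : ℂ)).re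

/-- `F` is a `β`-Morse function on the torus `ℝ/2πℤ`. -/
def BetaMorse (β : ℝ) (F : ℝ → ℝ) : Prop :=
  (∀ θ : ℝ, β ≤ |deriv F θ| + |deriv (deriv F) θ|) ∧
  (∀ θ₁ θ₂ : ℝ, deriv F θ₁ = 0 → deriv F θ₂ = 0 →
    (¬ ∃ m : ℤ, θ₁ - θ₂ = 2 * Real.pi * m) → β ≤ |F θ₁ - F θ₂|)

/-- `F` is a Morse function with distinct critical values on the torus `ℝ/2πℤ`. -/
def MorseWithDistinctValues (F : ℝ → ℝ) : Prop :=
  (∀ θ : ℝ, deriv F θ = 0 → deriv (deriv F) θ ≠ 0) ∧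
  (∀ θ₁ θ₂ : ℝ, deriv F θ₁ = 0 → deriv F θ₂ = 0 → F θ₁ = F θ₂ →
    ∃ m : ℤ, θ₁ - θ₂ = 2 * Real.pi * m)

/-- The liminf condition (P1): `liminf |f_k| e^{s|k|₁} |k|₁ⁿ > 0` along `k ∈ 𝒢ⁿ`. -/
def LiminfPos (n : ℕ) (s : ℝ) (c : (Fin n → ℤ) → ℂ) : Prop :=
  ∃ d : ℝ, 0 < d ∧ ∃ N : ℝ, ∀ k ∈ gen n, N ≤ (norm1 k : ℝ) →
    d ≤ ‖c k‖ * Real.exp (s * norm1 k) * (norm1 k : ℝ)^n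

/-- The generic class `𝔾ⁿₛ` (in terms of Fourier coefficients). -/
def Gset (n : ℕ) (s : ℝ) : Set ((Fin n → ℤ) → ℂ) :=
  {c | InBall n s c ∧ LiminfPos n s c ∧ ∀ k ∈ gen n, MorseWithDistinctValues (projR c k)}

/-- The class `𝔾ⁿₛ(δ,β)`. -/
def GsetDB (n : ℕ) (s δ β : ℝ) : Set ((Fin n → ℤ) → ℂ) :=
  {c | InBall n s c ∧ P1plus n s δ c ∧
    ∀ k ∈ gen n, (norm1 k : ℝ) ≤ Ncut n s δ → BetaMorse β (projR c k)}


open scoped Classical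

/-- The example `f(x) = 2 Σ_{k∈𝒢ⁿ} e^{-s|k|₁} cos(k·x)`, given by its Fourier
coefficients `f_k = e^{-s|k|₁}` for `±k ∈ 𝒢ⁿ` and `f_k = 0` otherwise. -/
def cex (n : ℕ) (s : ℝ) : (Fin n → ℤ) → ℂ :=
  fun k => if k ∈ gen n ∨ (-k) ∈ gen n then ((Real.exp (-(s * norm1 k)) : ℝ) : ℂ) else 0

lemma norm1_neg {n : ℕ} (k : Fin n → ℤ) : norm1 (-k) = norm1 k := by
  simp [norm1]

lemma zero_notMem_gen (n : ℕ) : (0 : Fin n → ℤ) ∉ gen n := by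
  rintro ⟨⟨j, hj, -⟩, -⟩
  simp at hj

lemma natAbs_eq_one_of_smul_mem_gen {n : ℕ} {k : Fin n → ℤ} {j : ℤ} (h : j • k ∈ gen n) :
    j.natAbs = 1 := by
  refine Nat.dvd_one.mp (h.2 ▸ Finset.dvd_gcd fun i _ => ?_)
  simp [Int.natAbs_mul]

lemma single_zero_mem_gen (n : ℕ) : (Pi.single 0 1 : Fin (n + 1) → ℤ) ∈ gen (n + 1) := by
  refine ⟨⟨0, by simp, fun i hi => absurd hi (Fin.not_lt_zero i)⟩, Nat.dvd_one.mp ?_⟩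
  simpa using Finset.gcd_dvd
    (f := fun i => ((Pi.single 0 1 : Fin (n + 1) → ℤ) i).natAbs) (Finset.mem_univ 0)

lemma cex_neg (n : ℕ) (s : ℝ) (k : Fin n → ℤ) : cex n s (-k) = cex n s k := by
  simp [cex, norm1_neg, or_comm]

lemma cex_of_mem_gen {n : ℕ} (s : ℝ) {k : Fin n → ℤ} (hk : k ∈ gen n) :
    cex n s k = ((Real.exp (-(s * norm1 k)) : ℝ) : ℂ) :=
  if_pos (Or.inl hk)

lemma norm_cex_mul_exp_of_mem_gen {n : ℕ} (s : ℝ) {k : Fin n → ℤ} (hk : k ∈ gen n) :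
    ‖cex n s k‖ * Real.exp (s * norm1 k) = 1 := by
  rw [cex_of_mem_gen s hk, Complex.norm_real, Real.norm_of_nonneg (Real.exp_nonneg _),
    ← Real.exp_add, neg_add_cancel, Real.exp_zero]

lemma inBall_cex (n : ℕ) (s : ℝ) : InBall n s (cex n s) where
  zero := by simp [cex, zero_notMem_gen]
  real k := by
    rw [cex_neg, cex]
    split_ifs
    · rw [Complex.conj_ofReal]
    · simp
  bound k := by
    by_cases h : k ∈ gen n
    · exact (norm_cex_mul_exp_of_mem_gen s h).le
    by_cases h' : -k ∈ gen n
    · rw [← cex_neg, ← norm1_neg]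
      exact (norm_cex_mul_exp_of_mem_gen s h').le
    · simp [cex, h, h']

lemma cex_smul_eq_zero {n : ℕ} (s : ℝ) (k : Fin n → ℤ) {j : ℤ} (hj : j.natAbs ≠ 1) :
    cex n s (j • k) = 0 := by
  refine if_neg ?_
  rintro (h | h)
  · exact hj (natAbs_eq_one_of_smul_mem_gen h)
  · rw [← neg_smul] at h
    exact hj (by simpa using natAbs_eq_one_of_smul_mem_gen h)

lemma projR_cex {n : ℕ} (s : ℝ) {k : Fin n → ℤ} (hk : k ∈ gen n) (θ : ℝ) :
    projR (cex n s) k θ = 2 * Real.exp (-(s * norm1 k)) * Real.cos θ := by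
  have key : projC (cex n s) k θ =
      ((2 * Real.exp (-(s * norm1 k)) * Real.cos θ : ℝ) : ℂ) := by
    rw [projC, tsum_eq_sum (s := {1, -1})]
    · rw [Finset.sum_pair (by decide)]
      simp only [one_ne_zero, if_false, one_smul, neg_eq_zero, neg_smul, cex_neg,
        cex_of_mem_gen s hk]
      push_cast
      rw [Complex.cos]
      ring_nf
    · intro j hj
      have hj' : j.natAbs ≠ 1 := by
        rw [Ne, Int.natAbs_eq_iff]
        simpa using hj
      rw [cex_smul_eq_zero s k hj', zero_mul, ite_self]
  rw [projR, key, Complex.ofReal_re]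

lemma iSup_norm_cex_mul_exp {n : ℕ} (hn : 1 ≤ n) (s : ℝ) :
    (⨆ k : Fin n → ℤ, ‖cex n s k‖ * Real.exp (s * norm1 k)) = 1 := by
  obtain ⟨m, rfl⟩ := Nat.exists_eq_add_of_le' hn
  refine le_antisymm (ciSup_le (inBall_cex _ s).bound) ?_
  rw [← norm_cex_mul_exp_of_mem_gen s (single_zero_mem_gen m)]
  exact le_ciSup (f := fun k => ‖cex (m + 1) s k‖ * Real.exp (s * norm1 k))
    ⟨1, Set.forall_mem_range.mpr (inBall_cex _ s).bound⟩ _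

lemma le_norm_cex_mul_exp_mul_pow {n : ℕ} (hn : 1 ≤ n) (s M : ℝ) {k : Fin n → ℤ}
    (hk : k ∈ gen n) (h : max 1 M ≤ (norm1 k : ℝ)) :
    M ≤ ‖cex n s k‖ * Real.exp (s * norm1 k) * (norm1 k : ℝ) ^ n := by
  rw [norm_cex_mul_exp_of_mem_gen s hk, one_mul]
  exact ((le_max_right _ _).trans h).trans
    (le_self_pow₀ ((le_max_left _ _).trans h) (Nat.one_le_iff_ne_zero.mp hn))

lemma morseWithDistinctValues_const_mul_cos {a : ℝ} (ha : a ≠ 0) :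
    MorseWithDistinctValues fun θ => a * Real.cos θ := by
  have h1 : deriv (fun θ => a * Real.cos θ) = fun θ => -a * Real.sin θ := by
    funext θ
    simp
  have h2 : deriv (fun θ => -a * Real.sin θ) = fun θ => -a * Real.cos θ := by
    funext θ
    simp
  simp only [MorseWithDistinctValues, h1, h2, mul_eq_zero, neg_eq_zero, ha, false_or, Ne]
  refine ⟨fun θ hs hc => ?_, fun x y hx hy hxy => ?_⟩
  · simpa [hs, hc] using Real.sin_sq_add_cos_sq θ
  · have hxy' := mul_left_cancel₀ ha hxy
    have h : Real.cos (x - y) = 1 := by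
      rw [Real.cos_sub, hx, hy, ← hxy']
      nlinarith [Real.sin_sq_add_cos_sq x]
    obtain ⟨m, hm⟩ := (Real.cos_eq_one_iff _).mp h
    exact ⟨m, by rw [← hm, mul_comm]⟩

theorem stmt_8 (n : ℕ) (hn : 1 ≤ n) (s : ℝ) (hs : 0 < s) :
    InBall n s (cex n s) ∧
    (⨆ k : Fin n → ℤ, ‖cex n s k‖ * Real.exp (s * norm1 k)) = 1 ∧
    (∀ k ∈ gen n, ∀ θ : ℝ,
      projR (cex n s) k θ = 2 * Real.exp (-(s * norm1 k)) * Real.cos θ) ∧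
    (∀ M : ℝ, ∃ N : ℝ, ∀ k ∈ gen n, N ≤ (norm1 k : ℝ) →
      M ≤ ‖cex n s k‖ * Real.exp (s * norm1 k) * (norm1 k : ℝ)^n) ∧
    cex n s ∈ Gset n s := by
  refine ⟨inBall_cex n s, iSup_norm_cex_mul_exp hn s, fun k hk => projR_cex s hk,
    fun M => ⟨max 1 M, fun k hk => le_norm_cex_mul_exp_mul_pow hn s M hk⟩, inBall_cex n s,
    ⟨1, one_pos, max 1 1, fun k hk => le_norm_cex_mul_exp_mul_pow hn s 1 hk⟩, fun k hk => ?_⟩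
  rw [funext (projR_cex s hk)]
  exact morseWithDistinctValues_const_mul_cos (by positivity)

end
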